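/- arXiv:1104.2072 — 2 statements merged into one kernel-verified Lean document; each statement's English description precedes it below -/
import Mathlib

section
/- Let k be a solid assignment and assume the constants (λ_z)_{z∈X∪Y} are generic. Then the least space of the vertex set V_k equals the kernel space 𝒟_k: Π(V_k) = 𝒟_k. -/
open MvPolynomial

noncomputable section

/-- The linear polynomial `p_x : t ↦ x ⬝ t`. -/
def pLin (n : ℕ) (x : Fin n → ℝ) : MvPolynomial (Fin n) ℝ :=
  ∑ i, MvPolynomial.C (x i) * MvPolynomial.X i

/-- `p_Z = ∏_{x ∈ Z} p_x` for a sub-multiset `Z` of the multiset indexed by `ι`. -/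
def pProd (n : ℕ) {ι : Type} (v : ι → Fin n → ℝ) (Z : Finset ι) : MvPolynomial (Fin n) ℝ :=
  ∏ a ∈ Z, pLin n (v a)

/-- `q_Z = ∏_{x ∈ Z} (p_x - λ_x)`. -/
def qProd (n : ℕ) {ι : Type} (v : ι → Fin n → ℝ) (lam : ι → ℝ) (Z : Finset ι) :
    MvPolynomial (Fin n) ℝ :=
  ∏ a ∈ Z, (pLin n (v a) - MvPolynomial.C (lam a))

/-- The pairing `⟨p,q⟩ = (p(∂)q)(0) = ∑_α α! p_α q_α`. -/
def pairing (n : ℕ) (p q : MvPolynomial (Fin n) ℝ) : ℝ :=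
  ∑ α ∈ p.support, p.coeff α * q.coeff α * (α.prod fun _ e => (Nat.factorial e : ℝ))

/-- `B` is a basis of the multiset: its vectors form a basis of `ℝ^n`. -/
def IsBasisSet (n : ℕ) {ι : Type} (v : ι → Fin n → ℝ) (B : Finset ι) : Prop :=
  LinearIndependent ℝ (fun b : B => v b) ∧ Submodule.span ℝ (v '' ↑B) = ⊤

/-- The ideal `𝒥_{𝔹'}` generated by the `p_Z` over all `Z` meeting every `B ∈ 𝔹'`. -/
def Jideal (n : ℕ) {ι : Type} [DecidableEq ι] (v : ι → Fin n → ℝ) (𝔹' : Set (Finset ι)) :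
    Ideal (MvPolynomial (Fin n) ℝ) :=
  Ideal.span {p | ∃ Z : Finset ι, (∀ B ∈ 𝔹', (Z ∩ B).Nonempty) ∧ p = pProd n v Z}

/-- The kernel space `𝒟_{𝔹'}`. -/
def Dspace (n : ℕ) {ι : Type} [DecidableEq ι] (v : ι → Fin n → ℝ) (𝔹' : Set (Finset ι)) :
    Submodule ℝ (MvPolynomial (Fin n) ℝ) where
  carrier := {f | ∀ g ∈ Jideal n v 𝔹', pairing n g f = 0}
  zero_mem' := by intro g _; simp [pairing]
  add_mem' := by
    intro a b ha hb g hg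
    have h : pairing n g (a + b) = pairing n g a + pairing n g b := by
      simp only [pairing, MvPolynomial.coeff_add]
      rw [← Finset.sum_add_distrib]
      exact Finset.sum_congr rfl fun α _ => by ring
    rw [h, ha g hg, hb g hg, add_zero]
  smul_mem' := by
    intro c f hf g hg
    have h : pairing n g (c • f) = c * pairing n g f := by
      simp only [pairing, MvPolynomial.coeff_smul, smul_eq_mul, Finset.mul_sum]
      exact Finset.sum_congr rfl fun α _ => by ring
    rw [h, hf g hg, mul_zero]

/-- A solid assignment `k : 2^X → ℕ`. -/
def Solid (n : ℕ) {ι : Type} (v : ι → Fin n → ℝ) (k : Finset ι → ℕ) : Prop :=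
  ∀ Z Z' : Finset ι,
    Submodule.span ℝ (v '' ↑Z) ≤ Submodule.span ℝ (v '' ↑Z') → k Z ≤ k Z'

/-- An incremental assignment. -/
def Incremental {ι : Type} [DecidableEq ι] (k : Finset ι → ℕ) : Prop :=
  ∀ (Z : Finset ι) (x : ι), k (insert x Z) ≤ k Z + 1

/-- `m(I) = k(I) + n - #I`. -/
def mVal (n : ℕ) {ι : Type} (k : Finset ι → ℕ) (I : Finset ι) : ℕ := k I + n - I.card

/-- `B ∩ X` for `B ⊆ X ∪ Y`. -/
def leftPart {ι : Type} [Fintype ι] [DecidableEq ι] {M : ℕ} (B : Finset (ι ⊕ Fin M)) :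
    Finset ι :=
  Finset.univ.filter fun i => Sum.inl i ∈ B

/-- `B ∩ Y` for `B ⊆ X ∪ Y`, as a set of indices in `Y`. -/
def rightPart {ι : Type} [Fintype ι] [DecidableEq ι] {M : ℕ} (B : Finset (ι ⊕ Fin M)) :
    Finset (Fin M) :=
  Finset.univ.filter fun j => Sum.inr j ∈ B

/-- `Y_i = {y_1, …, y_i}` as a set of indices. -/
def YFin {M : ℕ} (i : ℕ) : Finset (Fin M) := Finset.univ.filter fun j => (j : ℕ) < i

/-- `X ∪ Y_i` as a subset of the index set of `X ∪ Y`. -/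
def XYup (ι : Type) [Fintype ι] [DecidableEq ι] (M : ℕ) (i : ℕ) : Finset (ι ⊕ Fin M) :=
  Finset.univ.image Sum.inl ∪ (YFin (M := M) i).image Sum.inr

/-- `Y` is in general position in `X ∪ Y`: no `y ∈ Y` lies in the span of fewer than `n`
vectors of `(X ∪ Y) ∖ {y}`. -/
def GeneralPosition (n : ℕ) {ι : Type} [Fintype ι] [DecidableEq ι] {M : ℕ}
    (v : ι → Fin n → ℝ) (y : Fin M → Fin n → ℝ) : Prop :=
  ∀ (j : Fin M) (S : Finset (ι ⊕ Fin M)), Sum.inr j ∉ S → S.card < n →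
    y j ∉ Submodule.span ℝ (Sum.elim v y '' ↑S)

/-- `𝔹_k : the bases `B` of `X ∪ Y` with `B ∩ Y ⊆ Y_{m(B ∩ X)}`. -/
def Bk (n : ℕ) {ι : Type} [Fintype ι] [DecidableEq ι] (v : ι → Fin n → ℝ) {M : ℕ}
    (y : Fin M → Fin n → ℝ) (k : Finset ι → ℕ) : Set (Finset (ι ⊕ Fin M)) :=
  {B | IsBasisSet n (Sum.elim v y) B ∧
    ∀ j : Fin M, Sum.inr j ∈ B → (j : ℕ) < mVal n k (leftPart B)}

/-- The space `𝒫_k = ∑_{Z ⊆ X} p_{X∖Z} Π_{k(Z)}`. -/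
def Pspace (n : ℕ) {ι : Type} [Fintype ι] [DecidableEq ι] (v : ι → Fin n → ℝ)
    (k : Finset ι → ℕ) : Submodule ℝ (MvPolynomial (Fin n) ℝ) :=
  ⨆ Z : Finset ι,
    Submodule.map (LinearMap.mulLeft ℝ (pProd n v (Finset.univ \ Z)))
      (MvPolynomial.restrictTotalDegree (Fin n) ℝ (k Z))

/-- The constants `λ` are generic: each basis `B` determines a point `bp B` at which
`q_z` vanishes exactly when `z ∈ B`. -/
def Generic (n : ℕ) {ι : Type} (v : ι → Fin n → ℝ) (lam : ι → ℝ)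
    (bp : Finset ι → Fin n → ℝ) : Prop :=
  ∀ B : Finset ι, IsBasisSet n v B →
    ∀ z : ι, MvPolynomial.eval (bp B) (pLin n (v z) - MvPolynomial.C (lam z)) = 0 ↔ z ∈ B

/-- `x` is placable in `𝔹'`. -/
def Placable {ι : Type} [DecidableEq ι] (x : ι) (𝔹' : Set (Finset ι)) : Prop :=
  ∀ B ∈ 𝔹', ∃ a ∈ B, (insert x B).erase a ∈ 𝔹'

/-- `𝔹'` is placible. -/
inductive Placible {ι : Type} [DecidableEq ι] : Set (Finset ι) → Prop
  | singleton (B : Finset ι) : Placible {B}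
  | split (𝔹' : Set (Finset ι)) (x : ι) (hx : Placable x 𝔹')
      (hne1 : {B ∈ 𝔹' | x ∈ B}.Nonempty) (hne2 : {B ∈ 𝔹' | x ∉ B}.Nonempty)
      (hp1 : Placible {B ∈ 𝔹' | x ∈ B}) (hp2 : Placible {B ∈ 𝔹' | x ∉ B}) :
      Placible 𝔹'

/-- `X(I)` : the elements of `X ∖ I` not in the span of the earlier elements of `I`. -/
def XsetI (n : ℕ) {ι : Type} [Fintype ι] [DecidableEq ι] [LinearOrder ι]
    (v : ι → Fin n → ℝ) (I : Finset ι) : Finset ι := by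
  classical
  exact Finset.univ.filter fun x =>
    x ∉ I ∧ v x ∉ Submodule.span ℝ (v '' {b | b ∈ I ∧ b < x})

/-- `X'(B)` for `B ⊆ X ∪ Y`, with the order on `X ∪ Y` putting `X` (with its own order)
before `Y` (ordered as given). -/
def XprimeB (n : ℕ) {ι : Type} [Fintype ι] [DecidableEq ι] [LinearOrder ι] {M : ℕ}
    (v : ι → Fin n → ℝ) (y : Fin M → Fin n → ℝ) (B : Finset (ι ⊕ Fin M)) :
    Finset (ι ⊕ Fin M) := by
  classical
  exact Finset.univ.filter fun z =>
    z ∉ B ∧ Sum.elim v y z ∉ Submodule.span ℝ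
      (Sum.elim v y '' {b | b ∈ B ∧ Sum.Lex (· < ·) (· < ·) b z})

/-- The least space `Π(Θ)`. -/
def leastSpace (n : ℕ) (Θ : Finset (Fin n → ℝ)) : Submodule ℝ (MvPolynomial (Fin n) ℝ) :=
  Submodule.span ℝ
    {f | ∃ (c : (Fin n → ℝ) → ℝ) (J : ℕ),
      f = (Nat.factorial J : ℝ)⁻¹ • ∑ θ ∈ Θ, c θ • pLin n θ ^ J ∧ f ≠ 0 ∧
      ∀ j < J, ∑ θ ∈ Θ, c θ • pLin n θ ^ j = 0}

/-- The central space `𝒫(X)`, spanned by the `p_Z` over short `Z`. -/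
def centralP (n : ℕ) {ι : Type} [Fintype ι] [DecidableEq ι] (v : ι → Fin n → ℝ) :
    Submodule ℝ (MvPolynomial (Fin n) ℝ) :=
  Submodule.span ℝ
    {p | ∃ Z : Finset ι, Submodule.span ℝ (v '' ↑(Finset.univ \ Z)) = ⊤ ∧ p = pProd n v Z}

end

theorem pairing_eq_sum {n : ℕ} (p q : MvPolynomial (Fin n) ℝ) (S : Finset (Fin n →₀ ℕ))
    (h : p.support ⊆ S) :
    pairing n p q = ∑ α ∈ S, p.coeff α * q.coeff α * (α.prod fun _ e => (Nat.factorial e : ℝ)) := by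
  unfold pairing
  refine Finset.sum_subset h ?_
  intro α _ hα
  rw [MvPolynomial.notMem_support_iff] at hα
  simp [hα]

theorem pairing_add_left {n : ℕ} (p p' q : MvPolynomial (Fin n) ℝ) :
    pairing n (p + p') q = pairing n p q + pairing n p' q := by
  classical
  have h1 : p.support ⊆ p.support ∪ p'.support := Finset.subset_union_left
  have h2 : p'.support ⊆ p.support ∪ p'.support := Finset.subset_union_right
  rw [pairing_eq_sum _ q _ (MvPolynomial.support_add (p := p) (q := p')), pairing_eq_sum p q _ h1,
    pairing_eq_sum p' q _ h2, ← Finset.sum_add_distrib]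
  refine Finset.sum_congr rfl fun α _ => ?_
  rw [MvPolynomial.coeff_add]; ring

theorem pairing_smul_left {n : ℕ} (c : ℝ) (p q : MvPolynomial (Fin n) ℝ) :
    pairing n (c • p) q = c * pairing n p q := by
  rw [pairing_eq_sum (c • p) q p.support MvPolynomial.support_smul, pairing, Finset.mul_sum]
  refine Finset.sum_congr rfl fun α _ => ?_
  rw [MvPolynomial.coeff_smul, smul_eq_mul]; ring

theorem pairing_add_right {n : ℕ} (p q q' : MvPolynomial (Fin n) ℝ) :
    pairing n p (q + q') = pairing n p q + pairing n p q' := by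
  unfold pairing
  rw [← Finset.sum_add_distrib]
  refine Finset.sum_congr rfl fun α _ => ?_
  rw [MvPolynomial.coeff_add]; ring

theorem pairing_smul_right {n : ℕ} (c : ℝ) (p q : MvPolynomial (Fin n) ℝ) :
    pairing n p (c • q) = c * pairing n p q := by
  unfold pairing
  rw [Finset.mul_sum]
  refine Finset.sum_congr rfl fun α _ => ?_
  rw [MvPolynomial.coeff_smul, smul_eq_mul]; ring

noncomputable def pairL (n : ℕ) :
    MvPolynomial (Fin n) ℝ →ₗ[ℝ] MvPolynomial (Fin n) ℝ →ₗ[ℝ] ℝ :=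
  LinearMap.mk₂ ℝ (pairing n) pairing_add_left pairing_smul_left pairing_add_right
    pairing_smul_right

theorem pairL_apply {n : ℕ} (p q : MvPolynomial (Fin n) ℝ) : pairL n p q = pairing n p q := rfl

theorem pairing_self_ne {n : ℕ} (f : MvPolynomial (Fin n) ℝ) (hf : f ≠ 0) :
    pairing n f f ≠ 0 := by
  apply ne_of_gt
  unfold pairing
  apply Finset.sum_pos
  · intro α hα
    have h := MvPolynomial.mem_support_iff.1 hα
    have h3 : (0:ℝ) < α.prod fun _ e => (Nat.factorial e : ℝ) :=
      Finset.prod_pos fun i _ => by positivity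
    have := mul_self_pos.2 h
    positivity
  · exact MvPolynomial.support_nonempty.2 hf

theorem pairing_pow {n : ℕ} (p : MvPolynomial (Fin n) ℝ) (θ : Fin n → ℝ) (j : ℕ)
    (hp : p.IsHomogeneous j) :
    pairing n p (pLin n θ ^ j) = (Nat.factorial j : ℝ) * MvPolynomial.eval θ p := by
  have hl : pLin n θ = ∑ i, θ i • (X i : MvPolynomial (Fin n) ℝ) := by
    simp [pLin, MvPolynomial.smul_eq_C_mul]
  unfold pairing
  rw [MvPolynomial.eval_eq, Finset.mul_sum]
  refine Finset.sum_congr rfl fun α hα => ?_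
  have hd : α.sum (fun _ m => m) = j := by
    have := hp (MvPolynomial.mem_support_iff.1 hα)
    rw [← this]
    simp [Finsupp.weight_apply]
  rw [hl, coeff_linearCombination_X_pow_of_fintype, if_pos hd]
  have hm : ((α.prod fun _ e => (Nat.factorial e : ℝ))) * (α.multinomial : ℝ) = (Nat.factorial j : ℝ) := by
    have := Nat.multinomial_spec α.support α
    rw [← hd]
    unfold Finsupp.prod Finsupp.sum
    rw [← this]
    push_cast
    rfl
  rw [← hm]
  simp only [Finsupp.prod]
  ring

theorem pairing_pow_ne {n : ℕ} (p : MvPolynomial (Fin n) ℝ) (θ : Fin n → ℝ) (i j : ℕ)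
    (hp : p.IsHomogeneous i) (hij : i ≠ j) :
    pairing n p (pLin n θ ^ j) = 0 := by
  have hl : pLin n θ = ∑ i, θ i • (X i : MvPolynomial (Fin n) ℝ) := by
    simp [pLin, MvPolynomial.smul_eq_C_mul]
  unfold pairing
  refine Finset.sum_eq_zero fun α hα => ?_
  have hd : α.sum (fun _ m => m) = i := by
    have := hp (MvPolynomial.mem_support_iff.1 hα)
    rw [← this]
    simp [Finsupp.weight_apply]
  rw [hl, coeff_linearCombination_X_pow_of_fintype, if_neg (by omega)]
  simp

theorem pLin_homog {n : ℕ} (x : Fin n → ℝ) : (pLin n x).IsHomogeneous 1 := by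
  unfold pLin
  apply MvPolynomial.IsHomogeneous.sum
  intro i _
  exact MvPolynomial.isHomogeneous_C_mul_X _ _

theorem pProd_homog {n : ℕ} {κ : Type} (w : κ → Fin n → ℝ) (Z : Finset κ) :
    (pProd n w Z).IsHomogeneous Z.card := by
  unfold pProd
  have := MvPolynomial.IsHomogeneous.prod Z (fun a => pLin n (w a)) (fun _ => 1)
    (fun a _ => pLin_homog _)
  simpa using this

/-- `Φ(p) = ∑ c_θ p(θ)` -/
noncomputable def Phi (n : ℕ) (Θ : Finset (Fin n → ℝ)) (c : (Fin n → ℝ) → ℝ) :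
    MvPolynomial (Fin n) ℝ →ₗ[ℝ] ℝ :=
  ∑ θ ∈ Θ, c θ • (MvPolynomial.aeval (R := ℝ) θ).toLinearMap

theorem Phi_apply {n : ℕ} (Θ : Finset (Fin n → ℝ)) (c : (Fin n → ℝ) → ℝ)
    (p : MvPolynomial (Fin n) ℝ) : Phi n Θ c p = ∑ θ ∈ Θ, c θ * MvPolynomial.eval θ p := by
  simp [Phi, MvPolynomial.aeval_eq_eval]

theorem Phi_homog {n : ℕ} (Θ : Finset (Fin n → ℝ)) (c : (Fin n → ℝ) → ℝ)
    (p : MvPolynomial (Fin n) ℝ) (j : ℕ) (hp : p.IsHomogeneous j) :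
    pairing n p (∑ θ ∈ Θ, c θ • pLin n θ ^ j) = (Nat.factorial j : ℝ) * Phi n Θ c p := by
  rw [← pairL_apply, map_sum, Phi_apply, Finset.mul_sum]
  refine Finset.sum_congr rfl fun θ _ => ?_
  rw [map_smul, pairL_apply, pairing_pow p θ j hp, smul_eq_mul]
  ring

theorem Phi_homog_ne {n : ℕ} (Θ : Finset (Fin n → ℝ)) (c : (Fin n → ℝ) → ℝ)
    (p : MvPolynomial (Fin n) ℝ) (i j : ℕ) (hp : p.IsHomogeneous i) (hij : i ≠ j) :
    pairing n p (∑ θ ∈ Θ, c θ • pLin n θ ^ j) = 0 := by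
  rw [← pairL_apply, map_sum]
  refine Finset.sum_eq_zero fun θ _ => ?_
  rw [map_smul, pairL_apply, pairing_pow_ne p θ i j hp hij, smul_zero]

theorem Phi_zero_of_homog {n : ℕ} (Θ : Finset (Fin n → ℝ)) (c : (Fin n → ℝ) → ℝ)
    (p : MvPolynomial (Fin n) ℝ) (j : ℕ) (hp : p.IsHomogeneous j)
    (h : ∑ θ ∈ Θ, c θ • pLin n θ ^ j = 0) : Phi n Θ c p = 0 := by
  have h1 := Phi_homog Θ c p j hp
  rw [h, ← pairL_apply, map_zero] at h1
  rcases mul_eq_zero.1 h1.symm with h2 | h2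
  · exact absurd h2 (by positivity)
  · exact h2

theorem Phi_zero_of_lt {n : ℕ} (Θ : Finset (Fin n → ℝ)) (c : (Fin n → ℝ) → ℝ) (J : ℕ)
    (h : ∀ j < J, ∑ θ ∈ Θ, c θ • pLin n θ ^ j = 0)
    (p : MvPolynomial (Fin n) ℝ) (hp : p.totalDegree < J) : Phi n Θ c p = 0 := by
  rw [← MvPolynomial.sum_homogeneousComponent p, map_sum]
  refine Finset.sum_eq_zero fun i hi => ?_
  have := Finset.mem_range.1 hi
  exact Phi_zero_of_homog Θ c _ i (MvPolynomial.homogeneousComponent_isHomogeneous i p)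
    (h i (by omega))

theorem Phi_p_eq_q {n : ℕ} {κ : Type} [DecidableEq κ] (w : κ → Fin n → ℝ) (lam : κ → ℝ)
    (Θ : Finset (Fin n → ℝ)) (c : (Fin n → ℝ) → ℝ) (J : ℕ)
    (h : ∀ j < J, ∑ θ ∈ Θ, c θ • pLin n θ ^ j = 0) (Z : Finset κ) :
    ∀ g : MvPolynomial (Fin n) ℝ, g.totalDegree + Z.card ≤ J →
      Phi n Θ c (g * pProd n w Z) = Phi n Θ c (g * qProd n w lam Z) := by
  induction Z using Finset.induction_on with
  | empty => intro g _; simp [pProd, qProd]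
  | insert a Z ha ih =>
    intro g hg
    rw [Finset.card_insert_of_notMem ha] at hg
    have hp : pProd n w (insert a Z) = pLin n (w a) * pProd n w Z := by
      simp [pProd, Finset.prod_insert ha]
    have hq : qProd n w lam (insert a Z) = (pLin n (w a) - C (lam a)) * qProd n w lam Z := by
      simp [qProd, Finset.prod_insert ha]
    have e1 : g * (pLin n (w a) * pProd n w Z) = (g * pLin n (w a)) * pProd n w Z := by ring
    have e2 : g * ((pLin n (w a) - C (lam a)) * qProd n w lam Z) =
        (g * pLin n (w a)) * qProd n w lam Z - lam a • (g * qProd n w lam Z) := by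
      rw [MvPolynomial.smul_eq_C_mul]; ring
    have d1 : (g * pLin n (w a)).totalDegree ≤ g.totalDegree + 1 :=
      (MvPolynomial.totalDegree_mul _ _).trans
        (Nat.add_le_add_left (pLin_homog (w a)).totalDegree_le _)
    have d2 : (g * pProd n w Z).totalDegree ≤ g.totalDegree + Z.card :=
      (MvPolynomial.totalDegree_mul _ _).trans
        (Nat.add_le_add_left (pProd_homog w Z).totalDegree_le _)
    rw [hp, hq, e1, e2, map_sub, map_smul, ih _ (by omega), ← ih g (by omega),
      Phi_zero_of_lt Θ c J h (g * pProd n w Z) (by omega)]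
    simp

theorem least_le {n : ℕ} {κ : Type} [DecidableEq κ] (w : κ → Fin n → ℝ) (lam : κ → ℝ)
    (bp : Finset κ → Fin n → ℝ) (𝔹 : Set (Finset κ))
    (hb : ∀ B ∈ 𝔹, ∀ z ∈ B, MvPolynomial.eval (bp B) (pLin n (w z) - C (lam z)) = 0)
    (V : Finset (Fin n → ℝ)) (hV : ↑V = bp '' 𝔹) :
    leastSpace n V ≤ Dspace n w 𝔹 := by
  unfold leastSpace
  rw [Submodule.span_le]
  rintro f ⟨c, J, hf, hf0, hlow⟩
  change ∀ g ∈ Jideal n w 𝔹, pairing n g f = 0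
  intro g hg
  unfold Jideal at hg
  have key : ∀ (Z : Finset κ), (∀ B ∈ 𝔹, (Z ∩ B).Nonempty) → ∀ h : MvPolynomial (Fin n) ℝ,
      pairing n (h * pProd n w Z) f = 0 := by
    intro Z hZ h
    rw [← MvPolynomial.sum_homogeneousComponent h, Finset.sum_mul, ← pairL_apply, map_sum,
      LinearMap.sum_apply]
    refine Finset.sum_eq_zero fun d _ => ?_
    have hd := MvPolynomial.homogeneousComponent_isHomogeneous d h
    set hh := MvPolynomial.homogeneousComponent d h
    have hom := hd.mul (pProd_homog w Z)
    rw [hf, map_smul, pairL_apply]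
    by_cases hJ : d + Z.card = J
    · rw [hJ] at hom
      have hd' := hd.totalDegree_le
      rw [Phi_homog _ _ _ _ hom, Phi_p_eq_q w lam V c J hlow Z hh (by omega), Phi_apply]
      rw [Finset.sum_eq_zero]
      · simp
      · intro θ hθ
        have : θ ∈ bp '' 𝔹 := by rw [← hV]; exact hθ
        obtain ⟨B, hB, rfl⟩ := this
        obtain ⟨z, hz⟩ := hZ B hB
        rw [Finset.mem_inter] at hz
        have : MvPolynomial.eval (bp B) (qProd n w lam Z) = 0 := by
          rw [qProd, map_prod]
          exact Finset.prod_eq_zero hz.1 (hb B hB z hz.2)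
        rw [map_mul, this]; simp
    · rw [Phi_homog_ne _ _ _ _ _ hom hJ]; simp
  have gen : ∀ a : MvPolynomial (Fin n) ℝ, pairing n (a * g) f = 0 := by
    clear hf0
    induction hg using Submodule.span_induction with
    | mem x hx =>
      obtain ⟨Z, hZ, rfl⟩ := hx
      exact key Z hZ
    | zero => intro a; simp [pairing]
    | add x y _ _ hx hy => intro a; rw [mul_add, pairing_add_left, hx, hy, add_zero]
    | smul b x _ hx => intro a; rw [smul_eq_mul, ← mul_assoc]; exact hx _
  simpa using gen 1

theorem exists_interp {n : ℕ} (V : Finset (Fin n → ℝ)) (θ : Fin n → ℝ) :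
    ∃ p : MvPolynomial (Fin n) ℝ, MvPolynomial.eval θ p ≠ 0 ∧
      ∀ η ∈ V, η ≠ θ → MvPolynomial.eval η p = 0 := by
  classical
  refine ⟨∏ η ∈ V.erase θ, ∑ i, (X i - C (η i)) ^ 2, ?_, ?_⟩
  · rw [map_prod, Finset.prod_ne_zero_iff]
    intro η hη h
    simp only [map_sum, map_pow, map_sub, eval_X, eval_C] at h
    rw [Finset.sum_eq_zero_iff_of_nonneg (fun i _ => sq_nonneg _)] at h
    apply (Finset.mem_erase.1 hη).1
    funext i
    have := h i (Finset.mem_univ i)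
    rw [sq_eq_zero_iff] at this
    linarith
  · intro η hη hne
    rw [map_prod]
    exact Finset.prod_eq_zero (Finset.mem_erase.2 ⟨hne, hη⟩) (by simp)

theorem card_le_least {n : ℕ} (V : Finset (Fin n → ℝ)) (L : Submodule ℝ (MvPolynomial (Fin n) ℝ))
    [FiniteDimensional ℝ L] (hL : leastSpace n V ≤ L) :
    V.card ≤ Module.finrank ℝ L := by
  classical
  let ev : L →ₗ[ℝ] (V → ℝ) :=
    (LinearMap.pi fun θ : V => (MvPolynomial.aeval (R := ℝ) (θ : Fin n → ℝ)).toLinearMap) ∘ₗ L.subtype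
  have hev : ∀ (p : L) (θ : V), ev p θ = MvPolynomial.eval (θ : Fin n → ℝ) (p : MvPolynomial (Fin n) ℝ) := by
    intro p θ
    simp [ev, MvPolynomial.aeval_eq_eval]
  have hsurj : LinearMap.range ev = ⊤ := by
    by_contra hne
    obtain ⟨φ, hφ0, hφ⟩ := Submodule.exists_le_ker_of_lt_top _ (lt_top_iff_ne_top.2 hne)
    let c : (Fin n → ℝ) → ℝ := fun θ => if h : θ ∈ V then φ (Pi.single ⟨θ, h⟩ 1) else 0
    have hφc : ∀ g : V → ℝ, φ g = ∑ θ : V, c θ * g θ := by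
      intro g
      conv_lhs => rw [← Finset.univ_sum_single g]
      rw [map_sum]
      refine Finset.sum_congr rfl fun θ _ => ?_
      have : (Pi.single θ (g θ) : V → ℝ) = g θ • Pi.single θ 1 := by
        rw [← Pi.single_smul]; simp
      rw [this, map_smul]
      simp [c, mul_comm]
    have hΦ : ∀ p ∈ L, Phi n V c p = 0 := by
      intro p hp
      have h1 : φ (ev ⟨p, hp⟩) = 0 := by
        have := hφ (LinearMap.mem_range_self ev ⟨p, hp⟩)
        exact this
      rw [hφc] at h1
      rw [Phi_apply, ← Finset.sum_coe_sort]
      simpa [hev] using h1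
    by_cases hall : ∀ j, ∑ θ ∈ V, c θ • pLin n θ ^ j = 0
    · apply hφ0
      have hc : ∀ θ ∈ V, c θ = 0 := by
        intro θ hθ
        obtain ⟨p, hp1, hp2⟩ := exists_interp V θ
        have h1 := Phi_zero_of_lt V c (p.totalDegree + 1) (fun j _ => hall j) p (by omega)
        rw [Phi_apply, Finset.sum_eq_single_of_mem θ hθ (fun η hη hne => by rw [hp2 η hη hne, mul_zero])] at h1
        exact (mul_eq_zero.1 h1).resolve_right hp1
      refine LinearMap.ext fun g => ?_
      rw [hφc]
      exact Finset.sum_eq_zero fun θ _ => by rw [hc θ θ.2, zero_mul]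
    · push Not at hall
      have hJ := Nat.find_spec hall
      have hlow := fun j => Nat.find_min (H := hall) (m := j)
      set J := Nat.find hall
      have hlow' : ∀ j < J, ∑ θ ∈ V, c θ • pLin n θ ^ j = 0 := fun j hj => not_not.1 (hlow j hj)
      set F := ∑ θ ∈ V, c θ • pLin n θ ^ J with hF
      have hfac : (Nat.factorial J : ℝ)⁻¹ ≠ 0 := by positivity
      have hmem : (Nat.factorial J : ℝ)⁻¹ • F ∈ L :=
        hL (Submodule.subset_span ⟨c, J, rfl, smul_ne_zero hfac hJ, hlow'⟩)
      have hmem' : F ∈ L := (Submodule.smul_mem_iff _ hfac).1 hmem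
      have hhom : F.IsHomogeneous J := by
        apply MvPolynomial.IsHomogeneous.sum
        intro θ _
        rw [MvPolynomial.smul_eq_C_mul]
        have := (MvPolynomial.isHomogeneous_C (Fin n) (c θ)).mul ((pLin_homog θ).pow J)
        simpa using this
      have h1 := Phi_homog V c F J hhom
      rw [hΦ F hmem', mul_zero] at h1
      exact pairing_self_ne F hJ h1
  have := LinearMap.finrank_range_le ev
  rw [hsurj, finrank_top] at this
  simpa using this

/-- `Π / 𝒥` has dimension at most `#𝔹`. -/
def GoodFam (n : ℕ) {κ : Type} [DecidableEq κ] (w : κ → Fin n → ℝ) (𝔹 : Set (Finset κ)) : Prop :=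
  ∃ (W : List (MvPolynomial (Fin n) ℝ)), W.length ≤ 𝔹.ncard ∧
    ∀ f : MvPolynomial (Fin n) ℝ, ∃ u ∈ Submodule.span ℝ {g | g ∈ W}, f - u ∈ Jideal n w 𝔹

theorem good_empty (n : ℕ) {κ : Type} [DecidableEq κ] (w : κ → Fin n → ℝ) :
    GoodFam n w ∅ := by
  refine ⟨[], by simp, fun f => ⟨0, Submodule.zero_mem _, ?_⟩⟩
  have : (1 : MvPolynomial (Fin n) ℝ) ∈ Jideal n w ∅ :=
    Ideal.subset_span ⟨∅, by simp, by simp [pProd]⟩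
  rw [(Ideal.eq_top_iff_one _).2 this]
  trivial

theorem pLin_add {n : ℕ} (x y : Fin n → ℝ) : pLin n (x + y) = pLin n x + pLin n y := by
  simp [pLin, add_mul, Finset.sum_add_distrib]

theorem pLin_smul {n : ℕ} (c : ℝ) (x : Fin n → ℝ) : pLin n (c • x) = C c * pLin n x := by
  simp [pLin, Finset.mul_sum, mul_assoc]

theorem pLin_single {n : ℕ} (i : Fin n) : pLin n (Pi.single i 1) = X i := by
  classical
  unfold pLin
  rw [Finset.sum_eq_single i]
  · simp
  · intro j _ hj; simp [hj]
  · simp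

theorem good_singleton (n : ℕ) {κ : Type} [DecidableEq κ] (w : κ → Fin n → ℝ) (B : Finset κ)
    (hB : IsBasisSet n w B) : GoodFam n w {B} := by
  refine ⟨[1], by simp, fun f => ⟨C (coeff 0 f), ?_, ?_⟩⟩
  · have : (C (coeff 0 f) : MvPolynomial (Fin n) ℝ) = (coeff 0 f) • 1 := by
      rw [MvPolynomial.smul_eq_C_mul, mul_one]
    rw [this]
    exact Submodule.smul_mem _ _ (Submodule.subset_span (by simp))
  · have h1 : ∀ x : Fin n → ℝ, pLin n x ∈ Jideal n w {B} := by
      intro x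
      have hx : x ∈ Submodule.span ℝ (w '' ↑B) := by rw [hB.2]; trivial
      induction hx using Submodule.span_induction with
      | mem x hx =>
        obtain ⟨b, hb, rfl⟩ := hx
        refine Ideal.subset_span ⟨{b}, ?_, by simp [pProd]⟩
        intro B' hB'
        rw [Set.mem_singleton_iff] at hB'
        subst hB'
        exact ⟨b, by simpa using hb⟩
      | zero => 
        have : pLin n (0 : Fin n → ℝ) = 0 := by simp [pLin]
        rw [this]; exact Ideal.zero_mem _
      | add x y _ _ hx hy => rw [pLin_add]; exact Ideal.add_mem _ hx hy
      | smul c x _ hx => rw [pLin_smul]; exact Ideal.mul_mem_left _ _ hx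
    have h2 : ∀ i, (X i : MvPolynomial (Fin n) ℝ) ∈ Jideal n w {B} := fun i => by
      rw [← pLin_single]; exact h1 _
    induction f using MvPolynomial.induction_on with
    | C a => simp
    | add p q hp hq =>
      have : p + q - C (coeff 0 (p + q)) = (p - C (coeff 0 p)) + (q - C (coeff 0 q)) := by
        rw [coeff_add, C_add]; ring
      rw [this]; exact Ideal.add_mem _ hp hq
    | mul_X p i _ =>
      have : coeff 0 (p * X i) = 0 := by rw [coeff_mul_X']; simp
      rw [this, C_0, sub_zero]
      exact Ideal.mul_mem_left _ _ (h2 i)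

theorem good_split (n : ℕ) {κ : Type} [Fintype κ] [DecidableEq κ] (w : κ → Fin n → ℝ)
    (𝔹 : Set (Finset κ)) (x : κ)
    (hpl : (∀ B ∈ 𝔹, x ∉ B) ∨ ∀ B ∈ 𝔹, x ∉ B → ∃ a ∈ B, insert x (B.erase a) ∈ 𝔹)
    (h1 : GoodFam n w {B ∈ 𝔹 | x ∈ B}) (h2 : GoodFam n w {B ∈ 𝔹 | x ∉ B}) :
    GoodFam n w 𝔹 := by
  rcases hpl with hpl | hpl
  · have : {B ∈ 𝔹 | x ∉ B} = 𝔹 := by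
      ext B; exact ⟨fun h => h.1, fun h => ⟨h, hpl B h⟩⟩
    rwa [this] at h2
  obtain ⟨W1, hc1, hW1⟩ := h1
  obtain ⟨W2, hc2, hW2⟩ := h2
  refine ⟨W1 ++ W2.map (pLin n (w x) * ·), ?_, ?_⟩
  · rw [List.length_append, List.length_map]
    refine (Nat.add_le_add hc1 hc2).trans ?_
    rw [← Set.ncard_union_eq _ (Set.toFinite _) (Set.toFinite _)]
    · apply Set.ncard_le_ncard _ (Set.toFinite _)
      rintro B (hB | hB) <;> exact hB.1
    · rw [Set.disjoint_left]; intro B hB hB'; exact hB'.2 hB.2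
  · have hJ1 : ∀ g ∈ Jideal n w {B ∈ 𝔹 | x ∈ B}, ∃ r, g - pLin n (w x) * r ∈ Jideal n w 𝔹 := by
      intro g hg
      unfold Jideal at hg
      induction hg using Submodule.span_induction with
      | mem g hg =>
        obtain ⟨Z, hZ, rfl⟩ := hg
        by_cases hx : x ∈ Z
        · refine ⟨pProd n w (Z.erase x), ?_⟩
          have : pLin n (w x) * pProd n w (Z.erase x) = pProd n w Z :=
            Finset.mul_prod_erase Z (fun a => pLin n (w a)) hx
          rw [this, sub_self]; exact Ideal.zero_mem _
        · refine ⟨0, ?_⟩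
          rw [mul_zero, sub_zero]
          refine Ideal.subset_span ⟨Z, ?_, rfl⟩
          intro B hB
          by_cases hxB : x ∈ B
          · exact hZ B ⟨hB, hxB⟩
          · obtain ⟨a, ha, hB'⟩ := hpl B hB hxB
            obtain ⟨z, hz⟩ := hZ _ ⟨hB', Finset.mem_insert_self _ _⟩
            rw [Finset.mem_inter, Finset.mem_insert, Finset.mem_erase] at hz
            refine ⟨z, Finset.mem_inter.2 ⟨hz.1, ?_⟩⟩
            rcases hz.2 with h | h
            · exact absurd (h ▸ hz.1) hx
            · exact h.2
      | zero => exact ⟨0, by simp⟩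
      | add g g' _ _ hg hg' =>
        obtain ⟨r, hr⟩ := hg
        obtain ⟨r', hr'⟩ := hg'
        refine ⟨r + r', ?_⟩
        convert Ideal.add_mem _ hr hr' using 1
        ring
      | smul a g _ hg =>
        obtain ⟨r, hr⟩ := hg
        refine ⟨a * r, ?_⟩
        convert Ideal.mul_mem_left _ a hr using 1
        rw [smul_eq_mul]; ring
    have hJ2 : ∀ g ∈ Jideal n w {B ∈ 𝔹 | x ∉ B}, pLin n (w x) * g ∈ Jideal n w 𝔹 := by
      intro g hg
      unfold Jideal at hg
      induction hg using Submodule.span_induction with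
      | mem g hg =>
        obtain ⟨Z, hZ, rfl⟩ := hg
        have hmem : pProd n w (insert x Z) ∈ Jideal n w 𝔹 := by
          refine Ideal.subset_span ⟨insert x Z, ?_, rfl⟩
          intro B hB
          by_cases hxB : x ∈ B
          · exact ⟨x, by simp [hxB]⟩
          · obtain ⟨z, hz⟩ := hZ B ⟨hB, hxB⟩
            rw [Finset.mem_inter] at hz
            exact ⟨z, by simp [hz]⟩
        by_cases hx : x ∈ Z
        · rw [Finset.insert_eq_of_mem hx] at hmem
          exact Ideal.mul_mem_left _ _ hmem
        · rwa [pProd, Finset.prod_insert hx] at hmem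
      | zero => rw [mul_zero]; exact Ideal.zero_mem _
      | add g g' _ _ hg hg' => rw [mul_add]; exact Ideal.add_mem _ hg hg'
      | smul a g _ hg =>
        rw [smul_eq_mul, mul_left_comm]; exact Ideal.mul_mem_left _ _ hg
    intro f
    obtain ⟨u1, hu1, hf1⟩ := hW1 f
    obtain ⟨r, hr⟩ := hJ1 _ hf1
    obtain ⟨u2, hu2, hf2⟩ := hW2 r
    have hf2' := hJ2 _ hf2
    refine ⟨u1 + pLin n (w x) * u2, Submodule.add_mem _ ?_ ?_, ?_⟩
    · refine Submodule.span_mono ?_ hu1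
      intro g hg; simp only [Set.mem_ofPred_eq, List.mem_append] at hg ⊢; exact Or.inl hg
    · have hle : Submodule.span ℝ {g | g ∈ W2} ≤
          (Submodule.span ℝ {g | g ∈ W1 ++ W2.map (pLin n (w x) * ·)}).comap
            (LinearMap.mulLeft ℝ (pLin n (w x))) := by
        rw [Submodule.span_le]
        intro g hg
        apply Submodule.subset_span
        simp only [Set.mem_ofPred_eq, List.mem_append, List.mem_map] at hg ⊢
        exact Or.inr ⟨g, hg, rfl⟩
      exact hle hu2
    · convert Ideal.add_mem _ hr hf2' using 1
      ring

theorem good_finrank (n : ℕ) {κ : Type} [DecidableEq κ] (w : κ → Fin n → ℝ) (𝔹 : Set (Finset κ))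
    (h : GoodFam n w 𝔹) :
    FiniteDimensional ℝ (Dspace n w 𝔹) ∧ Module.finrank ℝ (Dspace n w 𝔹) ≤ 𝔹.ncard := by
  obtain ⟨W, hc, hW⟩ := h
  let T : Dspace n w 𝔹 →ₗ[ℝ] (Fin W.length → ℝ) :=
    (LinearMap.pi fun i => pairL n (W.get i)) ∘ₗ (Dspace n w 𝔹).subtype
  have hT : Function.Injective T := by
    rw [← LinearMap.ker_eq_bot, Submodule.eq_bot_iff]
    rintro ⟨f, hf⟩ hf0
    rw [LinearMap.mem_ker] at hf0
    have h1 : ∀ g ∈ W, pairing n g f = 0 := by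
      intro g hg
      obtain ⟨i, rfl⟩ := List.get_of_mem hg
      exact congrFun hf0 i
    obtain ⟨u, hu, hfu⟩ := hW f
    have h2 : pairing n u f = 0 := by
      have : Submodule.span ℝ {g | g ∈ W} ≤ LinearMap.ker ((pairL n).flip f) :=
        Submodule.span_le.2 fun g hg => h1 g hg
      exact this hu
    have h3 : pairing n (f - u) f = 0 := hf _ hfu
    have h4 : pairing n f f = 0 := by
      have := pairing_add_left (f - u) u f
      rw [sub_add_cancel, h2, h3, add_zero] at this
      exact this
    by_contra hne
    apply pairing_self_ne f _ h4
    intro h0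
    exact hne (Subtype.ext h0)
  refine ⟨FiniteDimensional.of_injective T hT, ?_⟩
  have := LinearMap.finrank_le_finrank_of_injective hT
  rw [Module.finrank_fin_fun] at this
  omega

theorem basis_iff (n : ℕ) {κ : Type} (w : κ → Fin n → ℝ) (B : Finset κ) :
    IsBasisSet n w B ↔ LinearIndepOn ℝ w (B : Set κ) ∧ B.card = n := by
  have hfr : Module.finrank ℝ (Fin n → ℝ) = n := by simp
  constructor
  · rintro ⟨h1, h2⟩
    refine ⟨h1, ?_⟩
    have := finrank_span_eq_card (b := fun b : B => w b) h1
    have hr : Set.range (fun b : B => w b) = w '' ↑B := by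
      ext z; simp
    rw [hr, h2, finrank_top, hfr] at this
    simpa using this.symm
  · rintro ⟨h1, h2⟩
    refine ⟨h1, ?_⟩
    have h1' : LinearIndependent ℝ (fun b : B => w b) := h1
    have := h1'.span_eq_top_of_card_eq_finrank' (by simpa using h2)
    have hr : Set.range (fun b : B => w b) = w '' ↑B := by
      ext z; simp
    rwa [hr] at this

theorem exchange (n : ℕ) {κ : Type} [DecidableEq κ] (w : κ → Fin n → ℝ) (B : Finset κ)
    (hB : IsBasisSet n w B) (x a : κ) (hx : x ∉ B) (ha : a ∈ B)
    (h : w x ∉ Submodule.span ℝ (w '' ↑(B.erase a))) :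
    IsBasisSet n w (insert x (B.erase a)) := by
  rw [basis_iff] at hB ⊢
  have hx' : x ∉ B.erase a := fun h => hx (Finset.mem_of_mem_erase h)
  refine ⟨?_, ?_⟩
  · rw [Finset.coe_insert, linearIndepOn_insert (by rwa [Finset.mem_coe])]
    exact ⟨hB.1.mono (by simp), h⟩
  · rw [Finset.card_insert_of_notMem hx', Finset.card_erase_of_mem ha]
    have : 0 < B.card := Finset.card_pos.2 ⟨a, ha⟩
    omega

theorem not_mem_span_erase (n : ℕ) {κ : Type} [DecidableEq κ] (w : κ → Fin n → ℝ) (B : Finset κ)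
    (hB : IsBasisSet n w B) (a : κ) (ha : a ∈ B) :
    w a ∉ Submodule.span ℝ (w '' ↑(B.erase a)) := by
  rw [basis_iff] at hB
  have h := hB.1
  rw [← Finset.insert_erase ha, Finset.coe_insert, linearIndepOn_insert (by simp)] at h
  exact h.2

theorem find_elem (n : ℕ) {κ : Type} [DecidableEq κ] (w : κ → Fin n → ℝ) (u : Fin n → ℝ)
    (S I : Finset κ) (hSI : S ⊆ I)
    (h1 : u ∈ Submodule.span ℝ (w '' ↑I)) (h2 : u ∉ Submodule.span ℝ (w '' ↑S)) :
    ∃ a ∈ I, a ∉ S ∧ w a ∈ Submodule.span ℝ (insert u (w '' ↑(I.erase a))) := by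
  induction I using Finset.strongInduction with
  | H I ih =>
    have hne : S ≠ I := by rintro rfl; exact h2 h1
    obtain ⟨b, hbI, hbS⟩ := Finset.exists_of_ssubset (hSI.ssubset_of_ne hne)
    by_cases hb : u ∈ Submodule.span ℝ (w '' ↑(I.erase b))
    · obtain ⟨a, ha, haS, hw⟩ := ih (I.erase b) (Finset.erase_ssubset hbI)
        (Finset.subset_erase.2 ⟨hSI, hbS⟩) hb
      refine ⟨a, Finset.mem_of_mem_erase ha, haS, Submodule.span_mono ?_ hw⟩
      apply Set.insert_subset_insert
      apply Set.image_mono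
      exact_mod_cast Finset.erase_subset_erase a (Finset.erase_subset b I)
    · refine ⟨b, hbI, hbS, ?_⟩
      have e : w '' ↑I = insert (w b) (w '' ↑(I.erase b)) := by
        rw [← Set.image_insert_eq, ← Finset.coe_insert, Finset.insert_erase hbI]
      rw [e] at h1
      exact mem_span_insert_exchange h1 hb

section fam
variable {n : ℕ} {ι : Type} [Fintype ι] [DecidableEq ι]
  {v : ι → Fin n → ℝ} {M : ℕ} {y : Fin M → Fin n → ℝ} {k : Finset ι → ℕ}

/-- bases in `𝔹_k` containing `S`, avoiding `T` -/
def Fam (n : ℕ) {ι : Type} [Fintype ι] [DecidableEq ι] (v : ι → Fin n → ℝ) {M : ℕ}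
    (y : Fin M → Fin n → ℝ) (k : Finset ι → ℕ) (S T : Finset (ι ⊕ Fin M)) :
    Set (Finset (ι ⊕ Fin M)) :=
  {B | B ∈ Bk n v y k ∧ S ⊆ B ∧ ∀ z ∈ T, z ∉ B}

theorem fam_step (S T : Finset (ι ⊕ Fin M)) (x : ι ⊕ Fin M)
    (hpl : ∀ B0 ∈ Fam n v y k S T, x ∈ B0 → ∀ B ∈ Fam n v y k S T, x ∉ B →
      ∃ a ∈ B, a ∉ S ∧ insert x (B.erase a) ∈ Bk n v y k)
    (h1 : GoodFam n (Sum.elim v y) (Fam n v y k (insert x S) T))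
    (h2 : GoodFam n (Sum.elim v y) (Fam n v y k S (insert x T))) :
    GoodFam n (Sum.elim v y) (Fam n v y k S T) := by
  have e1 : {B ∈ Fam n v y k S T | x ∈ B} = Fam n v y k (insert x S) T := by
    ext B
    simp only [Fam, Set.mem_ofPred_eq, Finset.insert_subset_iff]
    tauto
  have e2 : {B ∈ Fam n v y k S T | x ∉ B} = Fam n v y k S (insert x T) := by
    ext B
    simp only [Fam, Set.mem_ofPred_eq, Finset.forall_mem_insert]
    tauto
  apply good_split n _ _ x _ (e1 ▸ h1) (e2 ▸ h2)
  by_cases hex : ∃ B0 ∈ Fam n v y k S T, x ∈ B0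
  · right
    obtain ⟨B0, hB0, hx0⟩ := hex
    intro B hB hxB
    obtain ⟨a, ha, haS, hBk⟩ := hpl B0 hB0 hx0 B hB hxB
    refine ⟨a, ha, hBk, ?_, ?_⟩
    · intro s hs
      rw [Finset.mem_insert, Finset.mem_erase]
      right
      exact ⟨fun h => haS (h ▸ hs), hB.2.1 hs⟩
    · intro z hz hz'
      rw [Finset.mem_insert, Finset.mem_erase] at hz'
      rcases hz' with rfl | hz'
      · exact hB0.2.2 _ hz hx0
      · exact hB.2.2 _ hz hz'.2
  · left
    push Not at hex
    exact hex

theorem stageY (hgen : GeneralPosition n v y) (U : Finset (Fin M)) :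
    ∀ S T : Finset (ι ⊕ Fin M), (∀ z, z ∈ S ∨ z ∈ T ∨ ∃ j ∈ U, z = Sum.inr j) →
      GoodFam n (Sum.elim v y) (Fam n v y k S T) := by
  induction U using Finset.induction_on with
  | empty =>
    intro S T h
    have hsub : ∀ B ∈ Fam n v y k S T, B = S := by
      intro B hB
      apply Finset.Subset.antisymm _ hB.2.1
      intro z hz
      rcases h z with h | h | ⟨j, hj, _⟩
      · exact h
      · exact absurd hz (hB.2.2 z h)
      · simp at hj
    by_cases hS : S ∈ Fam n v y k S T
    · have : Fam n v y k S T = {S} := by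
        ext B; exact ⟨fun h => hsub B h, fun h => by rw [Set.mem_singleton_iff] at h; rwa [h]⟩
      rw [this]
      exact good_singleton n _ S hS.1.1
    · have : Fam n v y k S T = ∅ := by
        ext B
        refine ⟨fun h => hS (hsub B h ▸ h), fun h => absurd h (Set.notMem_empty _)⟩
      rw [this]
      exact good_empty n _
  | insert j U hj ih =>
    intro S T h
    have hT : ∀ z, z ∈ S ∨ z ∈ T ∨ z = Sum.inr j ∨ ∃ j ∈ U, z = Sum.inr j := by
      intro z
      rcases h z with h | h | ⟨j', hj', rfl⟩
      · exact Or.inl h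
      · exact Or.inr (Or.inl h)
      · rcases Finset.mem_insert.1 hj' with rfl | hj'
        · simp
        · exact Or.inr (Or.inr (Or.inr ⟨j', hj', rfl⟩))
    apply fam_step S T (Sum.inr j)
    · intro B0 hB0 hx0 B hB hxB
      have c0 := ((basis_iff _ _ _).1 hB0.1.1).2
      have c1 := ((basis_iff _ _ _).1 hB.1.1).2
      have hjS : Sum.inr j ∉ S := fun h => hxB (hB.2.1 h)
      have hlt : S.card < n := by
        rw [← c0]
        exact Finset.card_lt_card (Finset.ssubset_iff_of_subset hB0.2.1 |>.2 ⟨_, hx0, hjS⟩)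
      obtain ⟨a, ha, haS⟩ := Finset.exists_mem_notMem_of_card_lt_card (c1 ▸ hlt : S.card < B.card)
      have haY : ∃ j', a = Sum.inr j' := by
        rcases h a with h | h | ⟨j', _, h⟩
        · exact absurd h haS
        · exact absurd ha (hB.2.2 a h)
        · exact ⟨j', h⟩
      obtain ⟨j', rfl⟩ := haY
      have hle : ∀ B' ∈ Fam n v y k S T, ∀ i, Sum.inl i ∈ B' ↔ Sum.inl i ∈ S := by
        intro B' hB' i
        refine ⟨fun hi => ?_, fun hi => hB'.2.1 hi⟩
        rcases h (Sum.inl i) with h | h | ⟨j', _, h⟩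
        · exact h
        · exact absurd hi (hB'.2.2 _ h)
        · simp at h
      have hl0 : leftPart B0 = leftPart B := by
        ext i; simp [leftPart, hle B0 hB0, hle B hB]
      have hl1 : leftPart (insert (Sum.inr j) (B.erase (Sum.inr j'))) = leftPart B := by
        ext i; simp [leftPart]
      refine ⟨Sum.inr j', ha, haS, ?_, ?_⟩
      · apply exchange n _ B hB.1.1 _ _ hxB ha
        apply hgen j
        · intro h; exact hxB (Finset.mem_of_mem_erase h)
        · rw [Finset.card_erase_of_mem ha]; omega
      · rw [hl1]
        intro i hi
        rw [Finset.mem_insert] at hi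
        rcases hi with hi | hi
        · rw [Sum.inr.injEq] at hi
          subst hi
          rw [← hl0]; exact hB0.1.2 _ hx0
        · exact hB.1.2 _ (Finset.mem_of_mem_erase hi)
    · apply ih
      intro z
      rcases hT z with h | h | h | h <;> simp [h]
    · apply ih
      intro z
      rcases hT z with h | h | h | h <;> simp [h]

theorem image_left (B : Finset (ι ⊕ Fin M)) :
    Sum.elim v y '' ↑((leftPart B).image Sum.inl : Finset (ι ⊕ Fin M)) = v '' ↑(leftPart B) := by
  rw [Finset.coe_image, Set.image_image]
  rfl

theorem stageX (hgen : GeneralPosition n v y) (hsolid : Solid n v k) (U : Finset ι) :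
    ∀ S T : Finset (ι ⊕ Fin M), (∀ z ∈ S, ∃ i, z = Sum.inl i) →
      (∀ i, Sum.inl i ∈ S ∨ Sum.inl i ∈ T ∨ i ∈ U) →
      GoodFam n (Sum.elim v y) (Fam n v y k S T) := by
  induction U using Finset.induction_on with
  | empty =>
    intro S T _ h
    apply stageY hgen Finset.univ
    rintro (i | j)
    · rcases h i with h | h | h
      · exact Or.inl h
      · exact Or.inr (Or.inl h)
      · simp at h
    · exact Or.inr (Or.inr ⟨j, Finset.mem_univ _, rfl⟩)
  | insert i U hi ih =>
    intro S T hS h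
    apply fam_step S T (Sum.inl i)
    · intro B0 hB0 hx0 B hB hxB
      have hb0 := hB0.1.1
      have hb := hB.1.1
      have c1 := ((basis_iff _ _ _).1 hb).2
      set I : Finset (ι ⊕ Fin M) := (leftPart B).image Sum.inl with hI
      have hIB : I ⊆ B := by
        intro z hz
        rw [hI, Finset.mem_image] at hz
        obtain ⟨i', hi', rfl⟩ := hz
        simpa [leftPart] using hi'
      have hIi : ∀ i', Sum.inl i' ∈ I ↔ Sum.inl i' ∈ B := by
        intro i'; simp [hI, leftPart]
      have hIj : ∀ j, Sum.inr j ∉ I := by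
        intro j; simp [hI]
      by_cases hx : Sum.elim v y (Sum.inl i) ∈ Submodule.span ℝ (Sum.elim v y '' ↑I)
      · have hSI : S ⊆ I := by
          intro z hz
          obtain ⟨i', rfl⟩ := hS z hz
          exact (hIi i').2 (hB.2.1 hz)
        have hxS : Sum.elim v y (Sum.inl i) ∉ Submodule.span ℝ (Sum.elim v y '' ↑S) := by
          intro hs
          refine not_mem_span_erase n _ B0 hb0 _ hx0 (Submodule.span_mono ?_ hs)
          apply Set.image_mono
          intro z hz
          rw [Finset.mem_coe, Finset.mem_erase]
          exact ⟨fun h => hxB (hB.2.1 (h ▸ hz)), hB0.2.1 hz⟩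
        obtain ⟨a, haI, haS, hwa⟩ := find_elem n _ _ S I hSI hx hxS
        obtain ⟨i', rfl⟩ : ∃ i', a = Sum.inl i' := by
          rcases a with i' | j
          · exact ⟨i', rfl⟩
          · exact absurd haI (hIj j)
        have haB := hIB haI
        refine ⟨Sum.inl i', haB, haS, ?_, ?_⟩
        · apply exchange n _ B hb _ _ hxB haB
          intro hs
          apply not_mem_span_erase n _ B hb _ haB
          have : Submodule.span ℝ (insert (Sum.elim v y (Sum.inl i))
              (Sum.elim v y '' ↑(I.erase (Sum.inl i')))) ≤
              Submodule.span ℝ (Sum.elim v y '' ↑(B.erase (Sum.inl i'))) := by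
            rw [Submodule.span_le, Set.insert_subset_iff]
            refine ⟨hs, subset_trans (Set.image_mono ?_) Submodule.subset_span⟩
            exact_mod_cast Finset.erase_subset_erase _ hIB
          exact this hwa
        · set B' := insert (Sum.inl i) (B.erase (Sum.inl i')) with hB'
          have hl : leftPart B' = insert i ((leftPart B).erase i') := by
            ext i2
            simp [leftPart, hB']
          have hiB : i ∉ (leftPart B).erase i' := by
            simp [leftPart, hxB]
          have hi'B : i' ∈ leftPart B := by simpa [leftPart] using haB
          have hcard : (leftPart B').card = (leftPart B).card := by
            rw [hl, Finset.card_insert_of_notMem hiB, Finset.card_erase_of_mem hi'B]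
            have : 0 < (leftPart B).card := Finset.card_pos.2 ⟨_, hi'B⟩
            omega
          have hIe : Sum.elim v y '' ↑(I.erase (Sum.inl i')) = v '' ↑((leftPart B).erase i') := by
            have : I.erase (Sum.inl i') = ((leftPart B).erase i').image Sum.inl := by
              rw [hI, Finset.image_erase Sum.inl_injective]
            rw [this, Finset.coe_image, Set.image_image]
            rfl
          rw [hIe] at hwa
          have hk : k (leftPart B) ≤ k (leftPart B') := by
            apply hsolid
            rw [Submodule.span_le]
            rintro _ ⟨i2, hi2, rfl⟩
            by_cases h2 : i2 = i'
            · subst h2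
              refine Submodule.span_mono ?_ hwa
              rw [hl, Finset.coe_insert, Set.image_insert_eq]
              exact subset_rfl
            · apply Submodule.subset_span
              refine ⟨i2, ?_, rfl⟩
              rw [hl]
              have := Finset.mem_coe.1 hi2
              simp [h2, this]
          intro j hj
          have hjB : Sum.inr j ∈ B := by simpa [hB'] using hj
          have := hB.1.2 j hjB
          unfold mVal at this ⊢
          omega
      · have hex : (rightPart B).Nonempty := by
          by_contra hemp
          rw [Finset.not_nonempty_iff_eq_empty] at hemp
          apply hx
          have : I = B := by
            apply Finset.Subset.antisymm hIB
            rintro (i' | j) hz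
            · exact (hIi i').2 hz
            · have : j ∈ rightPart B := by simpa [rightPart] using hz
              rw [hemp] at this
              simp at this
          rw [this, hb.2]; trivial
        set j := (rightPart B).max' hex with hjdef
        have hjB : Sum.inr j ∈ B := by
          have := Finset.max'_mem _ hex
          rw [← hjdef] at this
          exact (Finset.mem_filter.1 this).2
        have hjmax : ∀ j', Sum.inr j' ∈ B → j' ≤ j := by
          intro j' hj'
          apply Finset.le_max'
          simpa [rightPart] using hj'
        have hnpos : 0 < B.card := Finset.card_pos.2 ⟨_, hjB⟩
        refine ⟨Sum.inr j, hjB, ?_, ?_, ?_⟩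
        · intro hj
          obtain ⟨i', hi'⟩ := hS _ hj
          simp at hi'
        · apply exchange n _ B hb _ _ hxB hjB
          intro hs
          have hIe : I ⊆ B.erase (Sum.inr j) := Finset.subset_erase.2 ⟨hIB, hIj j⟩
          obtain ⟨b, hbB, hbI, hwb⟩ := find_elem n _ _ I _ hIe hs hx
          obtain ⟨j', rfl⟩ : ∃ j', b = Sum.inr j' := by
            rcases b with i' | j'
            · exact absurd ((hIi i').2 (Finset.mem_of_mem_erase hbB)) hbI
            · exact ⟨j', rfl⟩
          rw [← Set.image_insert_eq, ← Finset.coe_insert] at hwb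
          refine hgen j' _ ?_ ?_ hwb
          · simp
          · refine (Finset.card_insert_le _ _).trans_lt ?_
            rw [Finset.card_erase_of_mem hbB, Finset.card_erase_of_mem hjB]
            have h1 : 0 < (B.erase (Sum.inr j)).card := Finset.card_pos.2 ⟨_, hbB⟩
            rw [Finset.card_erase_of_mem hjB] at h1
            omega
        · set B' := insert (Sum.inl i) (B.erase (Sum.inr j)) with hB'
          have hl : leftPart B' = insert i (leftPart B) := by
            ext i2
            simp [leftPart, hB']
          have hiB : i ∉ leftPart B := by simp [leftPart, hxB]
          have hcard : (leftPart B').card = (leftPart B).card + 1 := by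
            rw [hl, Finset.card_insert_of_notMem hiB]
          have hk : k (leftPart B) ≤ k (leftPart B') := by
            apply hsolid
            apply Submodule.span_mono
            apply Set.image_mono
            rw [hl]
            simp
          intro j' hj'
          have hj'' : Sum.inr j' ≠ (Sum.inr j : ι ⊕ Fin M) ∧ Sum.inr j' ∈ B := by
            simpa [hB'] using hj'
          have hne : j' ≠ j := fun h => hj''.1 (by rw [h])
          have hlt : j' < j := lt_of_le_of_ne (hjmax j' hj''.2) hne
          have hlt' : (j' : ℕ) < j := hlt
          have := hB.1.2 j hjB
          unfold mVal at this ⊢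
          omega
    · apply ih
      · intro z hz
        rcases Finset.mem_insert.1 hz with rfl | hz
        · exact ⟨i, rfl⟩
        · exact hS z hz
      · intro i2
        rcases h i2 with h | h | h
        · simp [h]
        · simp [h]
        · rcases Finset.mem_insert.1 h with rfl | h <;> simp [*]
    · apply ih _ _ hS
      intro i2
      rcases h i2 with h | h | h
      · simp [h]
      · simp [h]
      · rcases Finset.mem_insert.1 h with rfl | h <;> simp [*]

end fam


/-- for a solid assignment and generic constants, `Π(V_k) = 𝒟_k`. -/
theorem statement4
    (n : ℕ) (hn : 1 ≤ n) (ι : Type) [Fintype ι] [DecidableEq ι]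
    (v : ι → Fin n → ℝ) (M : ℕ) (y : Fin M → Fin n → ℝ)
    (hspan : Submodule.span ℝ (Set.range (Sum.elim v y)) = ⊤)
    (hgen : GeneralPosition n v y)
    (k : Finset ι → ℕ) (hsolid : Solid n v k)
    (hM : ∀ I : Finset ι, (LinearIndependent ℝ fun i : I => v i) → mVal n k I ≤ M)
    (lam : ι ⊕ Fin M → ℝ) (bp : Finset (ι ⊕ Fin M) → Fin n → ℝ)
    (hgeneric : Generic n (Sum.elim v y) lam bp)
    (V : Finset (Fin n → ℝ)) (hV : ↑V = bp '' Bk n v y k) :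
    leastSpace n V = Dspace n (Sum.elim v y) (Bk n v y k) := by
  have hgood : GoodFam n (Sum.elim v y) (Bk n v y k) := by
    have h := stageX (k := k) hgen hsolid Finset.univ ∅ ∅ (by simp) (by simp)
    have e : Fam n v y k (∅ : Finset (ι ⊕ Fin M)) ∅ = Bk n v y k := by
      ext B; simp [Fam]
    rwa [e] at h
  obtain ⟨hfin, hrank⟩ := good_finrank n _ _ hgood
  have hle : leastSpace n V ≤ Dspace n (Sum.elim v y) (Bk n v y k) :=
    least_le (Sum.elim v y) lam bp (Bk n v y k)
      (fun B hB z hz => (hgeneric B hB.1 z).2 hz) V hV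
  have hfin' : FiniteDimensional ℝ (leastSpace n V) := Submodule.finiteDimensional_of_le hle
  have hcard := card_le_least V (leastSpace n V) le_rfl
  have hinj : Set.InjOn bp (Bk n v y k) := by
    intro B hB B' hB' h
    ext z
    rw [← hgeneric B hB.1 z, h, hgeneric B' hB'.1 z]
  have hc : V.card = (Bk n v y k).ncard := by
    rw [← Set.ncard_coe_finset, hV, hinj.ncard_image]
  exact Submodule.eq_of_le_of_finrank_le hle (by omega)
end

section
/- Let k be a solid assignment. Then 𝒥_k + 𝒫_k = Π, i.e., every polynomial in n variables is the sum of an element of the ideal 𝒥_k and an element of the space 𝒫_k. -/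
open MvPolynomial

theorem aux_pLin_add (n : ℕ) (a b : Fin n → ℝ) : pLin n (a + b) = pLin n a + pLin n b := by
  simp [pLin, add_mul, Finset.sum_add_distrib]

theorem aux_pLin_smul (n : ℕ) (c : ℝ) (a : Fin n → ℝ) : pLin n (c • a) = C c * pLin n a := by
  simp [pLin, Finset.mul_sum, mul_assoc]

theorem aux_pLin_zero (n : ℕ) : pLin n 0 = 0 := by
  simp [pLin]

theorem aux_pLin_single (n : ℕ) (i : Fin n) : pLin n (Pi.single i 1) = X i := by
  unfold pLin
  rw [Finset.sum_eq_single i]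
  · simp
  · intro j _ hj
    simp [Pi.single_eq_of_ne hj]
  · simp

/-- If the family spans and multiplication by each `pLin` stays in `K`, so does mult by any. -/
theorem aux_lin_mem (n : ℕ) (K : Ideal (MvPolynomial (Fin n) ℝ)) (q : MvPolynomial (Fin n) ℝ)
    (S : Set (Fin n → ℝ)) (hS : Submodule.span ℝ S = ⊤) (h : ∀ s ∈ S, q * pLin n s ∈ K)
    (l : Fin n → ℝ) : q * pLin n l ∈ K := by
  have hl : l ∈ Submodule.span ℝ S := by rw [hS]; trivial
  induction hl using Submodule.span_induction with
  | mem x hx => exact h x hx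
  | zero => simp [aux_pLin_zero]
  | add a b _ _ ha hb => rw [aux_pLin_add, mul_add]; exact K.add_mem ha hb
  | smul c a _ ha =>
    rw [aux_pLin_smul, mul_left_comm]
    exact K.mul_mem_left _ ha

theorem aux_gp_indep (n : ℕ) {ι : Type} [Fintype ι] [DecidableEq ι] (v : ι → Fin n → ℝ) (M : ℕ)
    (y : Fin M → Fin n → ℝ) (hgen : GeneralPosition n v y) (I : Finset ι)
    (hI : LinearIndepOn ℝ v (I : Set ι)) (T : Finset (Fin M)) :
    I.card + T.card ≤ n → LinearIndepOn ℝ (Sum.elim v y) (I.disjSum T : Set (ι ⊕ Fin M)) := by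
  induction T using Finset.induction_on with
  | empty =>
    intro _
    have : (I.disjSum (∅ : Finset (Fin M)) : Set (ι ⊕ Fin M)) = Sum.inl '' (I : Set ι) := by
      ext z; simp
    rw [this]
    exact LinearIndepOn.image_of_comp _ _ (by simpa using hI)
  | insert a T ha ih =>
    intro hc
    rw [Finset.card_insert_of_notMem ha] at hc
    have : (I.disjSum (insert a T) : Set (ι ⊕ Fin M)) =
        insert (Sum.inr a) (I.disjSum T : Set (ι ⊕ Fin M)) := by
      ext z; rcases z with z | z <;> simp
    rw [this]
    refine (ih (by omega)).insert ?_
    exact hgen a (I.disjSum T) (by simpa using ha) (by rw [Finset.card_disjSum]; omega)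

theorem aux_gp_span (n : ℕ) {ι : Type} [Fintype ι] [DecidableEq ι] (v : ι → Fin n → ℝ) (M : ℕ)
    (y : Fin M → Fin n → ℝ) (hgen : GeneralPosition n v y) (I : Finset ι)
    (hI : LinearIndepOn ℝ v (I : Set ι)) (T : Finset (Fin M)) (hc : I.card + T.card = n) :
    Submodule.span ℝ (Sum.elim v y '' (I.disjSum T : Set (ι ⊕ Fin M))) = ⊤ := by
  have h := aux_gp_indep n v M y hgen I hI T hc.le
  have h2 := LinearIndependent.span_eq_top_of_card_eq_finrank' (K := ℝ)
    (b := fun b : (I.disjSum T : Finset (ι ⊕ Fin M)) => Sum.elim v y b) h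
    (by rw [Fintype.card_coe, Finset.card_disjSum, hc]; simp)
  rw [← h2]
  congr 1
  ext z; simp

/-- Key lemma. -/
theorem aux_key (n : ℕ) {ι : Type} [Fintype ι] [DecidableEq ι] (v : ι → Fin n → ℝ) (M : ℕ)
    (y : Fin M → Fin n → ℝ) (hgen : GeneralPosition n v y) (I : Finset ι)
    (hI : LinearIndepOn ℝ v (I : Set ι)) (hIn : I.card ≤ n) (Y : Finset (Fin M)) (κ : ℕ)
    (hY : κ + n ≤ Y.card + I.card)
    (K : Ideal (MvPolynomial (Fin n) ℝ)) (hK1 : ∀ i ∈ I, pLin n (v i) ∈ K)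
    (hK2 : ∀ W ⊆ Y, W.card = κ + 1 → pProd n y W ∈ K) (e : ℕ) :
    ∀ W ⊆ Y, W.card + e = κ + 1 → ∀ (s : Fin n →₀ ℕ) (c : ℝ), e ≤ s.degree →
      pProd n y W * monomial s c ∈ K := by
  induction e with
  | zero =>
    intro W hW hc s c _
    exact K.mul_mem_right _ (hK2 W hW hc)
  | succ e ih =>
    intro W hW hc s c hs
    have hs0 : s ≠ 0 := by
      rintro rfl
      simp at hs
    obtain ⟨i, hi⟩ := Finsupp.ne_iff.1 hs0
    have hle : Finsupp.single i 1 ≤ s := by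
      rw [Finsupp.single_le_iff]
      exact Nat.one_le_iff_ne_zero.2 hi
    obtain ⟨s', rfl⟩ := exists_add_of_le hle
    have hdeg : e ≤ s'.degree := by
      rw [map_add, Finsupp.degree_single] at hs
      omega
    have hcard : n - I.card ≤ (Y \ W).card := by
      rw [Finset.card_sdiff_of_subset hW]
      omega
    obtain ⟨T, hT, hTc⟩ := Finset.exists_subset_card_eq hcard
    have hsp := aux_gp_span n v M y hgen I hI T (by omega)
    have := aux_lin_mem n K (pProd n y W * monomial s' c) _ hsp ?_ (Pi.single i 1)
    · rw [aux_pLin_single, mul_assoc] at this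
      convert this using 2
      rw [X, monomial_mul, mul_one, add_comm]
    · rintro _ ⟨z, hz, rfl⟩
      rcases z with z | z
      · simp only [Finset.mem_coe, Finset.inl_mem_disjSum] at hz
        exact K.mul_mem_left _ (hK1 z hz)
      · simp only [Finset.mem_coe, Finset.inr_mem_disjSum] at hz
        have hz' := Finset.mem_sdiff.1 (hT hz)
        have := ih (insert z W) (Finset.insert_subset hz'.1 hW)
          (by rw [Finset.card_insert_of_notMem hz'.2]; omega) s' c hdeg
        rw [pProd, Finset.prod_insert hz'.2] at this
        convert this using 1
        simp only [Sum.elim_inr, pProd]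
        ring

/-- The ideal `{f | q f Π ⊆ N}`. -/
def auxIdeal (n : ℕ) (N : Submodule ℝ (MvPolynomial (Fin n) ℝ)) (q : MvPolynomial (Fin n) ℝ) :
    Ideal (MvPolynomial (Fin n) ℝ) where
  carrier := {f | ∀ g, q * (f * g) ∈ N}
  zero_mem' := by intro g; simp
  add_mem' := by
    intro a b ha hb g
    rw [add_mul, mul_add]
    exact N.add_mem (ha g) (hb g)
  smul_mem' := by
    intro c f hf g
    have := hf (c * g)
    rwa [← mul_assoc f, mul_comm f c] at this

theorem aux_hit (n : ℕ) {ι : Type} [Fintype ι] [DecidableEq ι]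
    (v : ι → Fin n → ℝ) (M : ℕ) (y : Fin M → Fin n → ℝ)
    (k : Finset ι → ℕ) (hsolid : Solid n v k) (Z I : Finset ι)
    (hI : LinearIndepOn ℝ v (I : Set ι)) (hIn : I.card ≤ n)
    (hIZ : Submodule.span ℝ (v '' (I : Set ι)) = Submodule.span ℝ (v '' (Z : Set ι)))
    (W : Finset (Fin M)) (hW : W ⊆ YFin (k Z + n - I.card)) (hWc : W.card = k Z + 1)
    (B : Finset (ι ⊕ Fin M)) (hB : B ∈ Bk n v y k) :
    (((Finset.univ \ Z).disjSum W) ∩ B).Nonempty := by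
  by_contra hne
  rw [Finset.not_nonempty_iff_eq_empty, ← Finset.disjoint_iff_inter_eq_empty,
    Finset.disjoint_left] at hne
  obtain ⟨⟨hBi, hBs⟩, hBy⟩ := hB
  have hL : leftPart B ⊆ Z := by
    intro i hi
    by_contra hiZ
    have : Sum.inl i ∈ B := by simpa [leftPart] using hi
    exact hne (by simpa using hiZ) this
  have hR : Disjoint (rightPart B) W := by
    rw [Finset.disjoint_left]
    intro j hj hjW
    have : Sum.inr j ∈ B := by simpa [rightPart] using hj
    exact hne (by simpa using hjW) this
  have hBd : B = (leftPart B).disjSum (rightPart B) := by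
    ext z; rcases z with z | z <;> simp [leftPart, rightPart]
  have hBc : B.card = n := by
    have h1 := finrank_span_eq_card hBi
    have h2 : Set.range (fun b : B => Sum.elim v y b) = Sum.elim v y '' (B : Set (ι ⊕ Fin M)) := by
      ext z; simp
    rw [h2, hBs, finrank_top, Module.finrank_fin_fun, Fintype.card_coe] at h1
    exact h1.symm
  have hsum : (leftPart B).card + (rightPart B).card = n := by
    rw [← Finset.card_disjSum, ← hBd, hBc]
  have hLi : LinearIndependent ℝ (fun b : leftPart B => v b) := by
    have hinj : Function.Injective
        (fun b : leftPart B => (⟨Sum.inl b.1, by simpa [leftPart] using b.2⟩ : B)) := by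
      intro a b hab
      exact Subtype.ext (Sum.inl_injective (congrArg Subtype.val hab))
    exact hBi.comp _ hinj
  have hLc : (leftPart B).card ≤ I.card := by
    have h1 := finrank_span_eq_card hLi
    have h2 := finrank_span_eq_card (R := ℝ) (b := fun b : I => v b) hI
    rw [Fintype.card_coe] at h1 h2
    rw [← h1, ← h2]
    apply Submodule.finrank_mono
    have h3 : Set.range (fun b : leftPart B => v b) = v '' (leftPart B : Set ι) := by
      ext z; simp
    have h4 : Set.range (fun b : I => v b) = v '' (I : Set ι) := by
      ext z; simp
    rw [h3, h4, hIZ]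
    exact Submodule.span_mono (Set.image_mono (by exact_mod_cast hL))
  have hkL : k (leftPart B) ≤ k Z :=
    hsolid _ _ (Submodule.span_mono (Set.image_mono (by exact_mod_cast hL)))
  have hsub : rightPart B ∪ W ⊆
      YFin (max (k Z + n - I.card) (k (leftPart B) + n - (leftPart B).card)) := by
    intro j hj
    rcases Finset.mem_union.1 hj with hj | hj
    · have := hBy j (by simpa [rightPart] using hj)
      simp only [YFin, Finset.mem_filter, Finset.mem_univ, true_and]
      exact lt_of_lt_of_le this (le_max_right _ _)
    · have := hW hj
      simp only [YFin, Finset.mem_filter, Finset.mem_univ, true_and] at this ⊢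
      exact lt_of_lt_of_le this (le_max_left _ _)
  have hcard := Finset.card_le_card hsub
  have hYc : ∀ i : ℕ, (YFin (M := M) i).card ≤ i := by
    intro i
    have : ((YFin (M := M) i).image (fun j : Fin M => (j : ℕ))) ⊆ Finset.range i := by
      intro a ha
      simp only [YFin, Finset.mem_image, Finset.mem_filter] at ha
      obtain ⟨j, hj, rfl⟩ := ha
      simpa using hj.2
    have h2 := Finset.card_le_card this
    rwa [Finset.card_image_of_injective _ Fin.val_injective, Finset.card_range] at h2
  rw [Finset.card_union_of_disjoint hR] at hcard
  have := hYc (max (k Z + n - I.card) (k (leftPart B) + n - (leftPart B).card))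
  omega

theorem aux_YFin_card (M i : ℕ) (h : i ≤ M) : i ≤ (YFin (M := M) i).card := by
  have : Finset.range i ⊆ ((YFin (M := M) i).image (fun j : Fin M => (j : ℕ))) := by
    intro a ha
    have ha' := Finset.mem_range.1 ha
    simp only [YFin, Finset.mem_image, Finset.mem_filter, Finset.mem_univ, true_and]
    exact ⟨⟨a, by omega⟩, ha', rfl⟩
  have h2 := Finset.card_le_card this
  rwa [Finset.card_image_of_injective _ Fin.val_injective, Finset.card_range] at h2

theorem aux_main
    (n : ℕ) (ι : Type) [Fintype ι] [DecidableEq ι]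
    (v : ι → Fin n → ℝ) (M : ℕ) (y : Fin M → Fin n → ℝ)
    (hgen : GeneralPosition n v y)
    (k : Finset ι → ℕ) (hsolid : Solid n v k)
    (hM : ∀ I : Finset ι, (LinearIndependent ℝ fun i : I => v i) → mVal n k I ≤ M)
    (N : Submodule ℝ (MvPolynomial (Fin n) ℝ))
    (hJ : ∀ g ∈ Jideal n (Sum.elim v y) (Bk n v y k), g ∈ N)
    (hP : Pspace n v k ≤ N) (Z : Finset ι) :
    ∀ f : MvPolynomial (Fin n) ℝ, pProd n v (Finset.univ \ Z) * f ∈ N := by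
  induction Z using Finset.strongInduction with
  | H Z ih =>
  obtain ⟨b, hbZ, -, hbs, hbi⟩ := exists_linearIndepOn_extension (K := ℝ) (v := v)
    (linearIndepOn_empty ℝ v) (Set.empty_subset (Z : Set ι))
  obtain ⟨I, rfl⟩ := (Z.finite_toSet.subset hbZ).exists_finset_coe
  have hIZ : Submodule.span ℝ (v '' (I : Set ι)) = Submodule.span ℝ (v '' (Z : Set ι)) :=
    le_antisymm (Submodule.span_mono (Set.image_mono hbZ)) (Submodule.span_le.2 hbs)
  have hIZ' : I ⊆ Z := by exact_mod_cast hbZ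
  have hIn : I.card ≤ n := by
    have := LinearIndependent.fintype_card_le_finrank (R := ℝ) (b := fun b : I => v b) hbi
    simpa using this
  have hk : k I = k Z := le_antisymm (hsolid _ _ hIZ.le) (hsolid _ _ hIZ.ge)
  have hm := hM I hbi
  rw [mVal, hk] at hm
  have hYc := aux_YFin_card M _ hm
  have hkey := aux_key n v M y hgen I hbi hIn (YFin (k Z + n - I.card)) (k Z) (by omega)
    (auxIdeal n N (pProd n v (Finset.univ \ Z))) ?_ ?_ (k Z + 1) ∅ (by simp) (by simp)
  · intro f
    induction f using MvPolynomial.induction_on' with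
    | add p q hp hq => rw [mul_add]; exact N.add_mem hp hq
    | monomial s c =>
      by_cases hs : k Z + 1 ≤ s.degree
      · have := hkey s c hs 1
        simpa [pProd] using this
      · apply hP
        refine Submodule.mem_iSup_of_mem Z ?_
        refine Submodule.mem_map.2 ⟨monomial s c, ?_, rfl⟩
        rw [mem_restrictTotalDegree]
        refine (totalDegree_monomial_le s c).trans ?_
        change s.degree ≤ k Z
        omega
  · intro i hi g
    have hiZ := hIZ' hi
    have := ih (Z.erase i) (Finset.erase_ssubset hiZ) g
    have he : Finset.univ \ Z.erase i = insert i (Finset.univ \ Z) := by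
      ext a; simp; tauto
    rw [he, pProd, Finset.prod_insert (by simpa using hiZ)] at this
    convert this using 1
    simp only [pProd]
    ring
  · intro W hW hWc g
    apply hJ
    rw [← mul_assoc]
    refine Ideal.mul_mem_right _ _ (Ideal.subset_span ⟨(Finset.univ \ Z).disjSum W, ?_, ?_⟩)
    · intro B hB
      exact aux_hit n v M y k hsolid Z I hbi hIn hIZ W hW hWc B hB
    · simp [pProd, Finset.prod_disjSum]

/-- for a solid assignment, `𝒥_k + 𝒫_k = Π`. -/
theorem statement6
    (n : ℕ) (hn : 1 ≤ n) (ι : Type) [Fintype ι] [DecidableEq ι]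
    (v : ι → Fin n → ℝ) (M : ℕ) (y : Fin M → Fin n → ℝ)
    (hspan : Submodule.span ℝ (Set.range (Sum.elim v y)) = ⊤)
    (hgen : GeneralPosition n v y)
    (k : Finset ι → ℕ) (hsolid : Solid n v k)
    (hM : ∀ I : Finset ι, (LinearIndependent ℝ fun i : I => v i) → mVal n k I ≤ M) :
    ∀ p : MvPolynomial (Fin n) ℝ,
      ∃ g ∈ Jideal n (Sum.elim v y) (Bk n v y k), ∃ q ∈ Pspace n v k, p = g + q := by
  intro p
  have h := aux_main n ι v M y hgen k hsolid hM
    ((Jideal n (Sum.elim v y) (Bk n v y k)).restrictScalars ℝ ⊔ Pspace n v k)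
    (fun g hg => Submodule.mem_sup_left hg) le_sup_right Finset.univ p
  have h2 : pProd n v (Finset.univ \ Finset.univ) * p = p := by simp [pProd]
  rw [h2] at h
  obtain ⟨g, hg, q, hq, hgq⟩ := Submodule.mem_sup.1 h
  exact ⟨g, hg, q, hq, hgq.symm⟩
end
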